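/- arXiv:math/0505614 — 2 statements merged into one kernel-verified Lean document; each statement's English description precedes it below -/
import Mathlib

section
/- The algebra U_{r,s}(so_{2n}) is a Hopf algebra, with comultiplication, counit and antipode determined on generators by Δ(ω_i^{±1}) = ω_i^{±1} ⊗ ω_i^{±1}, Δ(ω_i'^{±1}) = ω_i'^{±1} ⊗ ω_i'^{±1}, Δ(e_i) = e_i ⊗ 1 + ω_i ⊗ e_i, Δ(f_i) = 1 ⊗ f_i + f_i ⊗ ω_i', ε(ω_i^{±1}) = ε(ω_i'^{±1}) = 1, ε(e_i) = ε(f_i) = 0, S(ω_i^{±1}) = ω_i^{∓1}, S(ω_i'^{±1}) = ω_i'^{∓1}, S(e_i) = −ω_i^{-1}e_i, S(f_i) = −f_i ω_i'^{-1}; i.e., these assignments extend to well-defined algebra homomorphisms Δ : U → U ⊗ U and ε : U → K and an algebra antihomomorphism S : U → U satisfying the coassociativity, counit and antipode axioms of a Hopf algebra. -/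
/-!
STATEMENT 2.  The two-parameter quantum group U = U_{r,s}(so_{2n}) (type Dₙ; here the
rank is n+2 for a parameter n : ℕ, and all indices are 0-based, the last simple root
being α_{n+1} = ε_n + ε_{n+1}) is a Hopf algebra, with comultiplication, counit and
antipode determined on generators by
Δ(ω_i^{±1}) = ω_i^{±1} ⊗ ω_i^{±1}, Δ(ω_i'^{±1}) = ω_i'^{±1} ⊗ ω_i'^{±1},
Δ(e_i) = e_i ⊗ 1 + ω_i ⊗ e_i, Δ(f_i) = 1 ⊗ f_i + f_i ⊗ ω_i',
ε(ω_i^{±1}) = ε(ω_i'^{±1}) = 1, ε(e_i) = ε(f_i) = 0,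
S(ω_i^{±1}) = ω_i^{∓1}, S(ω_i'^{±1}) = ω_i'^{∓1}, S(e_i) = −ω_i⁻¹e_i,
S(f_i) = −f_iω_i'⁻¹, satisfying the coassociativity, counit and antipode axioms.
-/

noncomputable section
open scoped TensorProduct

/-- K = ℚ(r,s) -/
abbrev KK : Type := FractionRing (MvPolynomial (Fin 2) ℚ)
def qr : KK := algebraMap (MvPolynomial (Fin 2) ℚ) KK (MvPolynomial.X 0)
def qs : KK := algebraMap (MvPolynomial (Fin 2) ℚ) KK (MvPolynomial.X 1)

/-- generators e_i, f_i, ω_i^{±1}, ω_i'^{±1} -/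
inductive Gen (N : ℕ)
  | e (i : Fin N) | f (i : Fin N)
  | w (i : Fin N) | winv (i : Fin N) | wp (i : Fin N) | wpinv (i : Fin N)

def Gen.toral {N : ℕ} : Gen N → Prop
  | .e _ => False
  | .f _ => False
  | _ => True

/-- (ε_j, α_i) for type Dₙ of rank n+2 (0-indexed; α_i = ε_i − ε_{i+1} for i ≤ n,
α_{n+1} = ε_n + ε_{n+1}). -/
def ipaD (n : ℕ) (j i : ℕ) : ℤ :=
  if i < n+1 then (if j = i then 1 else 0) - (if j = i+1 then 1 else 0)
  else (if j = n ∨ j = n+1 then 1 else 0)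

/-- (α_i, α_j) -/
def apaD (n : ℕ) (i j : ℕ) : ℤ :=
  ∑ k ∈ Finset.range (n+2), ipaD n k i * ipaD n k j

abbrev FD (n : ℕ) : Type := FreeAlgebra KK (Gen (n+2))
abbrev XD {n : ℕ} : Gen (n+2) → FD n := FreeAlgebra.ι KK

/-- The defining relations (D1)–(D7) of U_{r,s}(so_{2(n+2)}). -/
inductive RelD (n : ℕ) : FD n → FD n → Prop
  -- (D1)
  | comm (g g' : Gen (n+2)) (hg : g.toral) (hg' : g'.toral) :
      RelD n (XD g * XD g') (XD g' * XD g)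
  | winv_r (i : Fin (n+2)) : RelD n (XD (.w i) * XD (.winv i)) 1
  | winv_l (i : Fin (n+2)) : RelD n (XD (.winv i) * XD (.w i)) 1
  | wpinv_r (i : Fin (n+2)) : RelD n (XD (.wp i) * XD (.wpinv i)) 1
  | wpinv_l (i : Fin (n+2)) : RelD n (XD (.wpinv i) * XD (.wp i)) 1
  -- (D2)
  | d2we (i j : Fin (n+2)) (hj : (j:ℕ) < n+1) :
      RelD n (XD (.w j) * XD (.e i) * XD (.winv j))
        ((qr^(ipaD n j i) * qs^(ipaD n ((j:ℕ)+1) i)) • XD (.e i))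
  | d2wf (i j : Fin (n+2)) (hj : (j:ℕ) < n+1) :
      RelD n (XD (.w j) * XD (.f i) * XD (.winv j))
        ((qr^(-(ipaD n j i)) * qs^(-(ipaD n ((j:ℕ)+1) i))) • XD (.f i))
  | d2wne (k : Fin (n+2)) (hk : (k:ℕ) ≠ n) :
      RelD n (XD (.w (Fin.last (n+1))) * XD (.e k) * XD (.winv (Fin.last (n+1))))
        ((qr^(ipaD n n k) * qs^(-(ipaD n (n+1) k))) • XD (.e k))
  | d2wnf (k : Fin (n+2)) (hk : (k:ℕ) ≠ n) :
      RelD n (XD (.w (Fin.last (n+1))) * XD (.f k) * XD (.winv (Fin.last (n+1))))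
        ((qr^(-(ipaD n n k)) * qs^(ipaD n (n+1) k)) • XD (.f k))
  | d2wnen1 (i : Fin (n+2)) (hi : (i:ℕ) = n) :
      RelD n (XD (.w (Fin.last (n+1))) * XD (.e i) * XD (.winv (Fin.last (n+1))))
        ((qr^(ipaD n (n+1) i) * qs^(-(ipaD n n i))) • XD (.e i))
  | d2wnfn1 (i : Fin (n+2)) (hi : (i:ℕ) = n) :
      RelD n (XD (.w (Fin.last (n+1))) * XD (.f i) * XD (.winv (Fin.last (n+1))))
        ((qr^(-(ipaD n (n+1) i)) * qs^(ipaD n n i)) • XD (.f i))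
  -- (D3)
  | d3wpe (i j : Fin (n+2)) (hj : (j:ℕ) < n+1) :
      RelD n (XD (.wp j) * XD (.e i) * XD (.wpinv j))
        ((qs^(ipaD n j i) * qr^(ipaD n ((j:ℕ)+1) i)) • XD (.e i))
  | d3wpf (i j : Fin (n+2)) (hj : (j:ℕ) < n+1) :
      RelD n (XD (.wp j) * XD (.f i) * XD (.wpinv j))
        ((qs^(-(ipaD n j i)) * qr^(-(ipaD n ((j:ℕ)+1) i))) • XD (.f i))
  | d3wpne (k : Fin (n+2)) (hk : (k:ℕ) ≠ n) :
      RelD n (XD (.wp (Fin.last (n+1))) * XD (.e k) * XD (.wpinv (Fin.last (n+1))))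
        ((qs^(ipaD n n k) * qr^(-(ipaD n (n+1) k))) • XD (.e k))
  | d3wpnf (k : Fin (n+2)) (hk : (k:ℕ) ≠ n) :
      RelD n (XD (.wp (Fin.last (n+1))) * XD (.f k) * XD (.wpinv (Fin.last (n+1))))
        ((qs^(-(ipaD n n k)) * qr^(ipaD n (n+1) k)) • XD (.f k))
  | d3wpnen1 (i : Fin (n+2)) (hi : (i:ℕ) = n) :
      RelD n (XD (.wp (Fin.last (n+1))) * XD (.e i) * XD (.wpinv (Fin.last (n+1))))
        ((qs^(ipaD n (n+1) i) * qr^(-(ipaD n n i))) • XD (.e i))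
  | d3wpnfn1 (i : Fin (n+2)) (hi : (i:ℕ) = n) :
      RelD n (XD (.wp (Fin.last (n+1))) * XD (.f i) * XD (.wpinv (Fin.last (n+1))))
        ((qs^(-(ipaD n (n+1) i)) * qr^(ipaD n n i)) • XD (.f i))
  -- (D4)
  | d4 (i j : Fin (n+2)) :
      RelD n (XD (.e i) * XD (.f j) - XD (.f j) * XD (.e i))
        (if i = j then (qr - qs)⁻¹ • (XD (.w i) - XD (.wp i)) else 0)
  -- (D5)
  | d5e (i j : Fin (n+2)) (hne : i ≠ j) (ha : apaD n i j = 0)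
      (hp1 : ¬((i:ℕ) = n ∧ (j:ℕ) = n+1)) (hp2 : ¬((i:ℕ) = n+1 ∧ (j:ℕ) = n)) :
      RelD n (XD (.e i) * XD (.e j) - XD (.e j) * XD (.e i)) 0
  | d5f (i j : Fin (n+2)) (hne : i ≠ j) (ha : apaD n i j = 0)
      (hp1 : ¬((i:ℕ) = n ∧ (j:ℕ) = n+1)) (hp2 : ¬((i:ℕ) = n+1 ∧ (j:ℕ) = n)) :
      RelD n (XD (.f i) * XD (.f j) - XD (.f j) * XD (.f i)) 0
  | d5en (i j : Fin (n+2)) (hi : (i:ℕ) = n) (hj : (j:ℕ) = n+1) :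
      RelD n (XD (.e i) * XD (.e j)) ((qr*qs) • (XD (.e j) * XD (.e i)))
  | d5fn (i j : Fin (n+2)) (hi : (i:ℕ) = n) (hj : (j:ℕ) = n+1) :
      RelD n (XD (.f j) * XD (.f i)) ((qr*qs) • (XD (.f i) * XD (.f j)))
  -- (D6)
  | d6a (i j : Fin (n+2)) (hij : i < j) (ha : apaD n i j = -1) :
      RelD n (XD (.e i)^2 * XD (.e j) - (qr + qs) • (XD (.e i) * XD (.e j) * XD (.e i))
        + (qr*qs) • (XD (.e j) * XD (.e i)^2)) 0
  | d6b (i j : Fin (n+2)) (hij : i < j) (ha : apaD n i j = -1) :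
      RelD n (XD (.e j)^2 * XD (.e i) - (qr⁻¹ + qs⁻¹) • (XD (.e j) * XD (.e i) * XD (.e j))
        + (qr*qs)⁻¹ • (XD (.e i) * XD (.e j)^2)) 0
  -- (D7)
  | d7a (i j : Fin (n+2)) (hij : i < j) (ha : apaD n i j = -1) :
      RelD n (XD (.f j) * XD (.f i)^2 - (qr + qs) • (XD (.f i) * XD (.f j) * XD (.f i))
        + (qr*qs) • (XD (.f i)^2 * XD (.f j))) 0
  | d7b (i j : Fin (n+2)) (hij : i < j) (ha : apaD n i j = -1) :
      RelD n (XD (.f i) * XD (.f j)^2 - (qr⁻¹ + qs⁻¹) • (XD (.f j) * XD (.f i) * XD (.f j))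
        + (qr*qs)⁻¹ • (XD (.f j)^2 * XD (.f i))) 0

/-- U_{r,s}(so_{2(n+2)}) -/
abbrev UD (n : ℕ) : Type := RingQuot (RelD n)

def genD (n : ℕ) (g : Gen (n+2)) : UD n := RingQuot.mkAlgHom KK (RelD n) (XD g)

/-- The quantum Serre polynomial `x²y - (p+q)xyx + pq yx²`. -/
def serre {K A : Type*} [CommRing K] [Ring A] [Algebra K A] (p q : K) (x y : A) : A :=
  x * x * y - (p + q) • (x * y * x) + (p * q) • (y * x * x)

section Serre

variable {K A B : Type*} [Field K] [Ring A] [Algebra K A] [Ring B] [Algebra K B]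

theorem serre_neg (p q : K) (x y : A) : serre p q (-x) (-y) = -serre p q x y := by
  simp only [serre, neg_mul, mul_neg, neg_neg, smul_neg]
  abel

theorem smul_serre_inv {p q : K} (hp : p ≠ 0) (hq : q ≠ 0) (x y : A) :
    (p * q) • serre p⁻¹ q⁻¹ x y = y * x * x - (p + q) • (x * y * x) + (p * q) • (x * x * y) := by
  rw [serre]
  match_scalars <;> field_simp
  ring

theorem serre_add {p q : K} (hp : p ≠ 0) (hq : q ≠ 0) {X Y Z T : A}
    (hYX : Y * X = (p * q⁻¹) • (X * Y)) (hTX : T * X = p⁻¹ • (X * T))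
    (hYZ : Y * Z = q • (Z * Y)) :
    serre p q (X + Y) (Z + T) = serre p q X Z + serre p q Y T := by
  have hYX' (b : A) : Y * (X * b) = (p * q⁻¹) • (X * (Y * b)) := by
    rw [← mul_assoc, hYX, smul_mul_assoc, mul_assoc]
  have hTX' (b : A) : T * (X * b) = p⁻¹ • (X * (T * b)) := by
    rw [← mul_assoc, hTX, smul_mul_assoc, mul_assoc]
  have hYZ' (b : A) : Y * (Z * b) = q • (Z * (Y * b)) := by
    rw [← mul_assoc, hYZ, smul_mul_assoc, mul_assoc]
  simp only [serre, mul_assoc, mul_add, add_mul, hYX, hTX, hYZ, hYX', hTX', hYZ',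
    mul_smul_comm, smul_mul_assoc, smul_add]
  match_scalars <;> field_simp <;> ring

theorem serre_tmul_right (p q : K) {u v : A} (huv : u * v = v * u) (x y : B) :
    serre p q (u ⊗ₜ[K] x) (v ⊗ₜ[K] y) = (u * u * v) ⊗ₜ[K] serre p q x y := by
  have h1 : u * v * u = u * u * v := by rw [mul_assoc, ← huv, mul_assoc]
  have h2 : v * u * u = u * u * v := by rw [← huv, h1]
  simp only [serre, Algebra.TensorProduct.tmul_mul_tmul, h1, h2, TensorProduct.tmul_add,
    TensorProduct.tmul_sub, TensorProduct.tmul_smul]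

theorem serre_tmul_left (p q : K) {u v : B} (huv : u * v = v * u) (x y : A) :
    serre p q (x ⊗ₜ[K] u) (y ⊗ₜ[K] v) = serre p q x y ⊗ₜ[K] (u * u * v) := by
  have h1 : u * v * u = u * u * v := by rw [mul_assoc, ← huv, mul_assoc]
  have h2 : v * u * u = u * u * v := by rw [← huv, h1]
  simp only [serre, Algebra.TensorProduct.tmul_mul_tmul, h1, h2, TensorProduct.add_tmul,
    TensorProduct.sub_tmul, TensorProduct.smul_tmul']

/-- The Serre polynomial of twisted elements in the opposite algebra. -/
theorem serre_op_twist {p q : K} (hp : p ≠ 0) (hq : q ≠ 0) {u v x y : A}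
    (huv : v * u = u * v) (hxu : x * u = (p * q⁻¹) • (u * x)) (hxv : x * v = p⁻¹ • (v * x))
    (hyu : y * u = q • (u * y)) :
    serre p q (MulOpposite.op (u * x)) (MulOpposite.op (v * y)) =
      MulOpposite.op (u * u * v * serre p q x y) := by
  have huv' (b : A) : v * (u * b) = u * (v * b) := by rw [← mul_assoc, huv, mul_assoc]
  have hxu' (b : A) : x * (u * b) = (p * q⁻¹) • (u * (x * b)) := by
    rw [← mul_assoc, hxu, smul_mul_assoc, mul_assoc]
  have hxv' (b : A) : x * (v * b) = p⁻¹ • (v * (x * b)) := by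
    rw [← mul_assoc, hxv, smul_mul_assoc, mul_assoc]
  have hyu' (b : A) : y * (u * b) = q • (u * (y * b)) := by
    rw [← mul_assoc, hyu, smul_mul_assoc, mul_assoc]
  simp only [serre, ← MulOpposite.op_mul, ← MulOpposite.op_smul, ← MulOpposite.op_add,
    ← MulOpposite.op_sub]
  congr 1
  simp only [mul_assoc, mul_add, mul_sub, huv', hxu', hxv', hyu', mul_smul_comm]
  match_scalars <;> field_simp

theorem serre_op_twist_right {p q : K} (hp : p ≠ 0) (hq : q ≠ 0) {u v x y : A}
    (huv : v * u = u * v) (hux : u * x = (q * p⁻¹) • (x * u)) (hvx : v * x = p • (x * v))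
    (huy : u * y = q⁻¹ • (y * u)) :
    serre p q (MulOpposite.op (x * u)) (MulOpposite.op (y * v)) =
      MulOpposite.op (serre p q x y * (u * u * v)) := by
  have huv' (b : A) : v * (u * b) = u * (v * b) := by rw [← mul_assoc, huv, mul_assoc]
  have hux' (b : A) : u * (x * b) = (q * p⁻¹) • (x * (u * b)) := by
    rw [← mul_assoc, hux, smul_mul_assoc, mul_assoc]
  have hvx' (b : A) : v * (x * b) = p • (x * (v * b)) := by
    rw [← mul_assoc, hvx, smul_mul_assoc, mul_assoc]
  have huy' (b : A) : u * (y * b) = q⁻¹ • (y * (u * b)) := by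
    rw [← mul_assoc, huy, smul_mul_assoc, mul_assoc]
  simp only [serre, ← MulOpposite.op_mul, ← MulOpposite.op_smul, ← MulOpposite.op_add,
    ← MulOpposite.op_sub]
  congr 1
  simp only [mul_assoc, add_mul, sub_mul, huv, huv', hux', hvx', huy', mul_smul_comm,
    smul_mul_assoc]
  match_scalars <;> field_simp

end Serre

theorem qr_ne_zero : qr ≠ 0 := by
  simp [qr, MvPolynomial.X_ne_zero]

theorem qs_ne_zero : qs ≠ 0 := by
  simp [qs, MvPolynomial.X_ne_zero]

/-- The structure constant in `ω_j e_i ω_j⁻¹ = cD n j i • e_i`. -/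
def cD (n : ℕ) (j i : Fin (n+2)) : KK :=
  if (j:ℕ) < n+1 then qr^(ipaD n j i) * qs^(ipaD n ((j:ℕ)+1) i)
  else if (i:ℕ) = n then qr^(ipaD n (n+1) i) * qs^(-(ipaD n n i))
  else qr^(ipaD n n i) * qs^(-(ipaD n (n+1) i))

theorem cD_ne_zero (n : ℕ) (j i : Fin (n+2)) : cD n j i ≠ 0 := by
  have hr := qr_ne_zero
  have hs := qs_ne_zero
  unfold cD
  split_ifs <;> exact mul_ne_zero (zpow_ne_zero _ hr) (zpow_ne_zero _ hs)

/-- The structure constants of the `ω_j'` are `(cD n i j)⁻¹`. -/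
theorem cD_inv_eq (n : ℕ) (j i : Fin (n+2)) :
    (cD n i j)⁻¹ =
      if (j:ℕ) < n+1 then qs^(ipaD n j i) * qr^(ipaD n ((j:ℕ)+1) i)
      else if (i:ℕ) = n then qs^(ipaD n (n+1) i) * qr^(-(ipaD n n i))
      else qs^(ipaD n n i) * qr^(-(ipaD n (n+1) i)) := by
  have hi := i.isLt
  have hj := j.isLt
  unfold cD
  split_ifs <;> rw [mul_inv, ← zpow_neg, ← zpow_neg, mul_comm] <;> congr 2 <;>
    (unfold ipaD; split_ifs <;> omega)

theorem apaD_eq (n : ℕ) (i j : Fin (n+2)) :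
    apaD n i j = if (i:ℕ) < n+1 then ipaD n i j - ipaD n ((i:ℕ)+1) j
      else ipaD n n j + ipaD n (n+1) j := by
  have hi := i.isLt
  unfold apaD
  split_ifs with h
  · simp only [ipaD.eq_1 n _ i, if_pos h, sub_mul, ite_mul, one_mul, zero_mul]
    rw [Finset.sum_sub_distrib, Finset.sum_ite_eq', Finset.sum_ite_eq',
      if_pos (Finset.mem_range.mpr hi), if_pos (Finset.mem_range.mpr (by omega))]
  · rw [Finset.sum_range_succ, Finset.sum_range_succ, Finset.sum_eq_zero]
    · simp [ipaD, h]
    · intro k hk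
      rw [Finset.mem_range] at hk
      rw [ipaD, if_neg h, if_neg (by omega), zero_mul]

theorem apaD_comm (n i j : ℕ) : apaD n i j = apaD n j i :=
  Finset.sum_congr rfl fun _ _ => mul_comm _ _

theorem cD_self (n : ℕ) (i : Fin (n+2)) : cD n i i = qr * qs⁻¹ := by
  have hi := i.isLt
  unfold cD
  split_ifs with h1 h2
  · have e1 : ipaD n i i = 1 := by unfold ipaD; split_ifs <;> omega
    have e2 : ipaD n ((i:ℕ)+1) i = -1 := by unfold ipaD; split_ifs <;> omega
    simp [e1, e2]
  · omega
  · have e1 : ipaD n n i = 1 := by unfold ipaD; split_ifs <;> omega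
    have e2 : ipaD n (n+1) i = 1 := by unfold ipaD; split_ifs <;> omega
    simp [e1, e2]

theorem cD_of_adj {n : ℕ} {i j : Fin (n+2)} (hij : i < j) (ha : apaD n i j = -1) :
    cD n i j = qs ∧ cD n j i = qr⁻¹ := by
  have hi := i.isLt
  have hj := j.isLt
  have hij' : (i:ℕ) < j := hij
  have h1 : (i:ℕ) < n + 1 := by omega
  rw [apaD_eq, if_pos h1] at ha
  constructor
  · rw [cD, if_pos h1]
    have e1 : ipaD n i j = 0 := by unfold ipaD at ha ⊢; split_ifs at ha ⊢ <;> omega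
    have e2 : ipaD n ((i:ℕ)+1) j = 1 := by omega
    simp [e1, e2]
  · have h (a b : ℤ) (ha : a = -1) (hb : b = 0) : qr ^ a * qs ^ b = qr⁻¹ := by
      simp [ha, hb]
    unfold cD
    split_ifs <;> apply h <;> unfold ipaD at ha ⊢ <;> split_ifs at ha ⊢ <;> omega

theorem cD_of_orthogonal {n : ℕ} {i j : Fin (n+2)} (hne : i ≠ j) (ha : apaD n i j = 0)
    (hp1 : ¬((i:ℕ) = n ∧ (j:ℕ) = n+1)) (hp2 : ¬((i:ℕ) = n+1 ∧ (j:ℕ) = n)) :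
    cD n i j = 1 := by
  have hi := i.isLt
  have hj := j.isLt
  have hne' : (i:ℕ) ≠ j := fun h => hne (Fin.ext h)
  have h (a b : ℤ) (ha : a = 0) (hb : b = 0) : qr ^ a * qs ^ b = 1 := by
    simp [ha, hb]
  rw [apaD_eq] at ha
  unfold cD
  split_ifs at ha ⊢ <;> apply h <;> unfold ipaD at ha ⊢ <;> split_ifs at ha ⊢ <;> omega

theorem cD_last {n : ℕ} {i j : Fin (n+2)} (hi : (i:ℕ) = n) (hj : (j:ℕ) = n+1) :
    cD n i j = qr * qs ∧ cD n j i = (qr * qs)⁻¹ := by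
  simp [cD, ipaD, hi, hj, mul_comm]

theorem cD_mul_of_orthogonal {n : ℕ} {i j : Fin (n+2)} (hne : i ≠ j) (ha : apaD n i j = 0) :
    cD n i j * cD n j i = 1 := by
  have hrs : qr * qs ≠ 0 := mul_ne_zero qr_ne_zero qs_ne_zero
  by_cases hp1 : (i:ℕ) = n ∧ (j:ℕ) = n+1
  · rw [(cD_last hp1.1 hp1.2).1, (cD_last hp1.1 hp1.2).2, mul_inv_cancel₀ hrs]
  by_cases hp2 : (i:ℕ) = n+1 ∧ (j:ℕ) = n
  · rw [(cD_last hp2.2 hp2.1).1, (cD_last hp2.2 hp2.1).2, inv_mul_cancel₀ hrs]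
  rw [cD_of_orthogonal hne ha hp1 hp2, cD_of_orthogonal hne.symm (by rwa [apaD_comm])
    (fun h => hp2 ⟨h.2, h.1⟩) (fun h => hp1 ⟨h.2, h.1⟩), one_mul]

theorem apaD_self_ne (n : ℕ) (i : Fin (n+2)) : apaD n i i ≠ -1 := by
  have hi := i.isLt
  rw [apaD_eq]
  unfold ipaD
  split_ifs <;> omega

theorem cD_self_of_adj {n : ℕ} {i j : Fin (n+2)} (ha : apaD n i j = -1) :
    cD n i i = (cD n j i)⁻¹ * (cD n i j)⁻¹ := by
  rw [cD_self]
  rcases lt_trichotomy i j with h | rfl | h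
  · rw [(cD_of_adj h ha).1, (cD_of_adj h ha).2, inv_inv]
  · exact absurd ha (apaD_self_ne n i)
  · rw [apaD_comm] at ha
    rw [(cD_of_adj h ha).1, (cD_of_adj h ha).2, inv_inv, mul_comm]

/-- Images of the generators in an algebra satisfying the defining relations in uniform shape. -/
structure IsRep (n : ℕ) {A : Type*} [Ring A] [Algebra KK A] (φ : Gen (n+2) → A) : Prop where
  comm (g g' : Gen (n+2)) (hg : g.toral) (hg' : g'.toral) : φ g * φ g' = φ g' * φ g
  w_mul_winv (i : Fin (n+2)) : φ (.w i) * φ (.winv i) = 1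
  wp_mul_wpinv (i : Fin (n+2)) : φ (.wp i) * φ (.wpinv i) = 1
  w_mul_e (j i : Fin (n+2)) : φ (.w j) * φ (.e i) = cD n j i • (φ (.e i) * φ (.w j))
  w_mul_f (j i : Fin (n+2)) : φ (.w j) * φ (.f i) = (cD n j i)⁻¹ • (φ (.f i) * φ (.w j))
  wp_mul_e (j i : Fin (n+2)) : φ (.wp j) * φ (.e i) = (cD n i j)⁻¹ • (φ (.e i) * φ (.wp j))
  wp_mul_f (j i : Fin (n+2)) : φ (.wp j) * φ (.f i) = cD n i j • (φ (.f i) * φ (.wp j))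
  e_mul_f (i j : Fin (n+2)) : φ (.e i) * φ (.f j) - φ (.f j) * φ (.e i) =
    if i = j then (qr - qs)⁻¹ • (φ (.w i) - φ (.wp i)) else 0
  e_mul_e (i j : Fin (n+2)) (hne : i ≠ j) (ha : apaD n i j = 0) :
    φ (.e i) * φ (.e j) = cD n i j • (φ (.e j) * φ (.e i))
  f_mul_f (i j : Fin (n+2)) (hne : i ≠ j) (ha : apaD n i j = 0) :
    φ (.f j) * φ (.f i) = cD n i j • (φ (.f i) * φ (.f j))
  serre_e (i j : Fin (n+2)) (ha : apaD n i j = -1) :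
    serre (cD n j i)⁻¹ (cD n i j) (φ (.e i)) (φ (.e j)) = 0
  serre_f (i j : Fin (n+2)) (ha : apaD n i j = -1) :
    serre (cD n i j)⁻¹ (cD n j i) (φ (.f i)) (φ (.f j)) = 0

section Twist

variable {K A : Type*} [Field K] [Ring A] [Algebra K A]

theorem conj_eq_smul_iff {w v x : A} {c : K} (hwv : w * v = 1) (hvw : v * w = 1) :
    w * x * v = c • x ↔ w * x = c • (x * w) := by
  constructor <;> intro h
  · rw [← smul_mul_assoc, ← h, mul_assoc, hvw, mul_one]
  · rw [h, smul_mul_assoc, mul_assoc, hwv, mul_one]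

theorem mul_inv_eq_smul {w v x : A} {c : K} (hwv : w * v = 1) (hvw : v * w = 1)
    (h : w * x = c • (x * w)) : x * v = c • (v * x) := by
  rw [← conj_eq_smul_iff hwv hvw] at h
  rw [← mul_smul_comm, ← h, ← mul_assoc, ← mul_assoc, hvw, one_mul]

theorem inv_mul_eq_smul {w v x : A} {c : K} (hc : c ≠ 0) (hwv : w * v = 1) (hvw : v * w = 1)
    (h : w * x = c • (x * w)) : v * x = c⁻¹ • (x * v) := by
  rw [mul_inv_eq_smul hwv hvw h, smul_smul, inv_mul_cancel₀ hc, one_smul]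

end Twist

namespace IsRep

variable {n : ℕ} {A : Type*} [Ring A] [Algebra KK A] {φ : Gen (n+2) → A}

theorem winv_mul_w (h : IsRep n φ) (i : Fin (n+2)) : φ (.winv i) * φ (.w i) = 1 := by
  rw [h.comm (.winv i) (.w i) trivial trivial, h.w_mul_winv]

theorem wpinv_mul_wp (h : IsRep n φ) (i : Fin (n+2)) : φ (.wpinv i) * φ (.wp i) = 1 := by
  rw [h.comm (.wpinv i) (.wp i) trivial trivial, h.wp_mul_wpinv]

theorem e_mul_winv (h : IsRep n φ) (i j : Fin (n+2)) :
    φ (.e i) * φ (.winv j) = cD n j i • (φ (.winv j) * φ (.e i)) :=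
  mul_inv_eq_smul (h.w_mul_winv j) (h.winv_mul_w j) (h.w_mul_e j i)

theorem f_mul_winv (h : IsRep n φ) (i j : Fin (n+2)) :
    φ (.f i) * φ (.winv j) = (cD n j i)⁻¹ • (φ (.winv j) * φ (.f i)) :=
  mul_inv_eq_smul (h.w_mul_winv j) (h.winv_mul_w j) (h.w_mul_f j i)

theorem wpinv_mul_e (h : IsRep n φ) (j i : Fin (n+2)) :
    φ (.wpinv j) * φ (.e i) = cD n i j • (φ (.e i) * φ (.wpinv j)) := by
  simpa using inv_mul_eq_smul (inv_ne_zero (cD_ne_zero n i j)) (h.wp_mul_wpinv j)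
    (h.wpinv_mul_wp j) (h.wp_mul_e j i)

theorem e_mul_wpinv (h : IsRep n φ) (i j : Fin (n+2)) :
    φ (.e i) * φ (.wpinv j) = (cD n i j)⁻¹ • (φ (.wpinv j) * φ (.e i)) :=
  mul_inv_eq_smul (h.wp_mul_wpinv j) (h.wpinv_mul_wp j) (h.wp_mul_e j i)

theorem wpinv_mul_f (h : IsRep n φ) (j i : Fin (n+2)) :
    φ (.wpinv j) * φ (.f i) = (cD n i j)⁻¹ • (φ (.f i) * φ (.wpinv j)) :=
  inv_mul_eq_smul (cD_ne_zero n i j) (h.wp_mul_wpinv j) (h.wpinv_mul_wp j) (h.wp_mul_f j i)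

theorem f_mul_wpinv (h : IsRep n φ) (i j : Fin (n+2)) :
    φ (.f i) * φ (.wpinv j) = cD n i j • (φ (.wpinv j) * φ (.f i)) :=
  mul_inv_eq_smul (h.wp_mul_wpinv j) (h.wpinv_mul_wp j) (h.wp_mul_f j i)

/-- A family satisfying the uniform relations satisfies the defining relations. -/
theorem lift_rel (h : IsRep n φ) {x y : FD n} (hxy : RelD n x y) :
    FreeAlgebra.lift KK φ x = FreeAlgebra.lift KK φ y := by
  have hr := qr_ne_zero
  have hs := qs_ne_zero
  have hw (i j) {c : KK} (hc : cD n j i = c) :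
      φ (.w j) * φ (.e i) * φ (.winv j) = c • φ (.e i) := by
    rw [conj_eq_smul_iff (h.w_mul_winv j) (h.winv_mul_w j), h.w_mul_e, hc]
  have hwf (i j) {c : KK} (hc : (cD n j i)⁻¹ = c) :
      φ (.w j) * φ (.f i) * φ (.winv j) = c • φ (.f i) := by
    rw [conj_eq_smul_iff (h.w_mul_winv j) (h.winv_mul_w j), h.w_mul_f, hc]
  have hwp (i j) {c : KK} (hc : (cD n i j)⁻¹ = c) :
      φ (.wp j) * φ (.e i) * φ (.wpinv j) = c • φ (.e i) := by
    rw [conj_eq_smul_iff (h.wp_mul_wpinv j) (h.wpinv_mul_wp j), h.wp_mul_e, hc]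
  have hwpf (i j) {c : KK} (hc : cD n i j = c) :
      φ (.wp j) * φ (.f i) * φ (.wpinv j) = c • φ (.f i) := by
    rw [conj_eq_smul_iff (h.wp_mul_wpinv j) (h.wpinv_mul_wp j), h.wp_mul_f, hc]
  have hlast : ¬((Fin.last (n+1) : Fin (n+2)) : ℕ) < n + 1 := by simp
  cases hxy <;> simp only [map_mul, map_sub, map_add, map_smul, map_one, map_zero, map_pow,
    FreeAlgebra.lift_ι_apply]
  case comm g g' hg hg' => exact h.comm g g' hg hg'
  case winv_r i => exact h.w_mul_winv i
  case winv_l i => exact h.winv_mul_w i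
  case wpinv_r i => exact h.wp_mul_wpinv i
  case wpinv_l i => exact h.wpinv_mul_wp i
  case d2we i j hj => exact hw i j (by rw [cD, if_pos hj])
  case d2wf i j hj => exact hwf i j (by rw [cD, if_pos hj, mul_inv, zpow_neg, zpow_neg])
  case d2wne i hi => exact hw i _ (by rw [cD, if_neg hlast, if_neg hi])
  case d2wnf i hi =>
    exact hwf i _ (by rw [cD, if_neg hlast, if_neg hi, mul_inv, zpow_neg, zpow_neg, inv_inv])
  case d2wnen1 i hi => exact hw i _ (by rw [cD, if_neg hlast, if_pos hi])
  case d2wnfn1 i hi =>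
    exact hwf i _ (by rw [cD, if_neg hlast, if_pos hi, mul_inv, zpow_neg, zpow_neg, inv_inv])
  case d3wpe i j hj => exact hwp i j (by rw [cD_inv_eq, if_pos hj])
  case d3wpf i j hj =>
    exact hwpf i j (by rw [← inv_inv (cD n i j), cD_inv_eq, if_pos hj, mul_inv, zpow_neg, zpow_neg])
  case d3wpne i hi => exact hwp i _ (by rw [cD_inv_eq, if_neg hlast, if_neg hi])
  case d3wpnf i hi =>
    exact hwpf i _ (by rw [← inv_inv (cD n i _), cD_inv_eq, if_neg hlast, if_neg hi, mul_inv,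
      zpow_neg, zpow_neg, inv_inv])
  case d3wpnen1 i hi => exact hwp i _ (by rw [cD_inv_eq, if_neg hlast, if_pos hi])
  case d3wpnfn1 i hi =>
    exact hwpf i _ (by rw [← inv_inv (cD n i _), cD_inv_eq, if_neg hlast, if_pos hi, mul_inv,
      zpow_neg, zpow_neg, inv_inv])
  case d4 i j =>
    rw [h.e_mul_f]
    split_ifs <;> simp
  case d5e i j hne ha hp1 hp2 =>
    rw [h.e_mul_e i j hne ha, cD_of_orthogonal hne ha hp1 hp2, one_smul, sub_self]
  case d5f i j hne ha hp1 hp2 =>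
    rw [h.f_mul_f i j hne ha, cD_of_orthogonal hne ha hp1 hp2, one_smul, sub_self]
  case d5en i j hi hj =>
    rw [h.e_mul_e i j (fun he => by subst he; omega) (by rw [apaD_eq]; simp [ipaD, hi, hj]),
      (cD_last hi hj).1]
  case d5fn i j hi hj =>
    rw [h.f_mul_f i j (fun he => by subst he; omega) (by rw [apaD_eq]; simp [ipaD, hi, hj]),
      (cD_last hi hj).1]
  case d6a i j hij ha =>
    have := h.serre_e i j ha
    rw [(cD_of_adj hij ha).1, (cD_of_adj hij ha).2, inv_inv] at this
    simpa only [serre, pow_two, mul_assoc] using this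
  case d6b i j hij ha =>
    have := h.serre_e j i (by rwa [apaD_comm])
    rw [(cD_of_adj hij ha).1, (cD_of_adj hij ha).2] at this
    simpa only [serre, pow_two, mul_assoc, mul_inv, mul_comm qs⁻¹, add_comm qs⁻¹] using this
  case d7a i j hij ha =>
    have := smul_serre_inv hs hr (φ (.f i)) (φ (.f j))
    rw [← (cD_of_adj hij ha).1, ← (cD_of_adj hij ha).2, h.serre_f i j ha, smul_zero,
      (cD_of_adj hij ha).1, mul_comm qs, add_comm qs] at this
    simpa only [pow_two, mul_assoc] using this.symm
  case d7b i j hij ha =>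
    have hf := h.serre_f j i (by rwa [apaD_comm])
    rw [(cD_of_adj hij ha).1, (cD_of_adj hij ha).2, ← inv_inv qs] at hf
    have := smul_serre_inv (inv_ne_zero hr) (inv_ne_zero hs) (φ (.f j)) (φ (.f i))
    rw [hf, smul_zero, ← mul_inv] at this
    simpa only [pow_two, mul_assoc] using this.symm

end IsRep

theorem genD_rel {n : ℕ} {x y : FD n} (hxy : RelD n x y) :
    FreeAlgebra.lift KK (genD n) x = FreeAlgebra.lift KK (genD n) y := by
  have hlift : FreeAlgebra.lift KK (genD n) = RingQuot.mkAlgHom KK (RelD n) := by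
    ext g
    simp [genD]
  rw [hlift, RingQuot.mkAlgHom_rel KK hxy]

theorem isRep_genD (n : ℕ) : IsRep n (genD n) := by
  have hr := qr_ne_zero
  have hs := qs_ne_zero
  have hwv (i : Fin (n+2)) := genD_rel (.winv_r i)
  have hvw (i : Fin (n+2)) := genD_rel (.winv_l i)
  have hwv' (i : Fin (n+2)) := genD_rel (.wpinv_r i)
  have hvw' (i : Fin (n+2)) := genD_rel (.wpinv_l i)
  simp only [map_mul, map_one, FreeAlgebra.lift_ι_apply] at hwv hvw hwv' hvw'
  have hlast (j : Fin (n+2)) (hj : ¬(j:ℕ) < n + 1) : j = Fin.last (n+1) :=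
    Fin.ext (by have := j.isLt; simp only [Fin.val_last]; omega)
  constructor
  case comm =>
    intro g g' hg hg'
    simpa using genD_rel (.comm g g' hg hg')
  case w_mul_winv => exact hwv
  case wp_mul_wpinv => exact hwv'
  case w_mul_e =>
    intro j i
    rw [← conj_eq_smul_iff (hwv j) (hvw j), cD]
    split_ifs with h1 h2
    · simpa using genD_rel (.d2we i j h1)
    · simpa [← hlast j h1] using genD_rel (.d2wnen1 i h2)
    · simpa [← hlast j h1] using genD_rel (.d2wne i h2)
  case w_mul_f =>
    intro j i
    rw [← conj_eq_smul_iff (hwv j) (hvw j), cD]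
    split_ifs with h1 h2
    · simpa [mul_comm] using genD_rel (.d2wf i j h1)
    · simpa [← hlast j h1, mul_comm] using genD_rel (.d2wnfn1 i h2)
    · simpa [← hlast j h1, mul_comm] using genD_rel (.d2wnf i h2)
  case wp_mul_e =>
    intro j i
    rw [← conj_eq_smul_iff (hwv' j) (hvw' j), cD_inv_eq]
    split_ifs with h1 h2
    · simpa using genD_rel (.d3wpe i j h1)
    · simpa [← hlast j h1] using genD_rel (.d3wpnen1 i h2)
    · simpa [← hlast j h1] using genD_rel (.d3wpne i h2)
  case wp_mul_f =>
    intro j i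
    rw [← conj_eq_smul_iff (hwv' j) (hvw' j), ← inv_inv (cD n i j), cD_inv_eq]
    split_ifs with h1 h2
    · simpa [mul_comm] using genD_rel (.d3wpf i j h1)
    · simpa [← hlast j h1, mul_comm] using genD_rel (.d3wpnfn1 i h2)
    · simpa [← hlast j h1, mul_comm] using genD_rel (.d3wpnf i h2)
  case e_mul_f =>
    intro i j
    have := genD_rel (.d4 i j)
    split_ifs at this ⊢ <;> simpa using this
  case e_mul_e =>
    intro i j hne ha
    by_cases hp1 : (i:ℕ) = n ∧ (j:ℕ) = n+1
    · rw [(cD_last hp1.1 hp1.2).1]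
      simpa using genD_rel (.d5en i j hp1.1 hp1.2)
    by_cases hp2 : (i:ℕ) = n+1 ∧ (j:ℕ) = n
    · have := genD_rel (.d5en j i hp2.2 hp2.1)
      simp only [map_mul, map_smul, FreeAlgebra.lift_ι_apply] at this
      rw [(cD_last hp2.2 hp2.1).2, this, inv_smul_smul₀ (mul_ne_zero hr hs)]
    · rw [cD_of_orthogonal hne ha hp1 hp2, one_smul, ← sub_eq_zero]
      simpa using genD_rel (.d5e i j hne ha hp1 hp2)
  case f_mul_f =>
    intro i j hne ha
    by_cases hp1 : (i:ℕ) = n ∧ (j:ℕ) = n+1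
    · rw [(cD_last hp1.1 hp1.2).1]
      simpa using genD_rel (.d5fn i j hp1.1 hp1.2)
    by_cases hp2 : (i:ℕ) = n+1 ∧ (j:ℕ) = n
    · have := genD_rel (.d5fn j i hp2.2 hp2.1)
      simp only [map_mul, map_smul, FreeAlgebra.lift_ι_apply] at this
      rw [(cD_last hp2.2 hp2.1).2, this, inv_smul_smul₀ (mul_ne_zero hr hs)]
    · rw [cD_of_orthogonal hne ha hp1 hp2, one_smul, eq_comm, ← sub_eq_zero]
      simpa using genD_rel (.d5f i j hne ha hp1 hp2)
  case serre_e =>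
    intro i j ha
    rcases lt_trichotomy i j with hij | rfl | hij
    · have := genD_rel (.d6a i j hij ha)
      simp only [map_mul, map_sub, map_add, map_smul, map_zero, map_pow,
        FreeAlgebra.lift_ι_apply] at this
      rw [(cD_of_adj hij ha).1, (cD_of_adj hij ha).2, inv_inv]
      simpa only [serre, pow_two, mul_assoc] using this
    · exact absurd ha (apaD_self_ne n i)
    · rw [apaD_comm] at ha
      have := genD_rel (.d6b j i hij ha)
      simp only [map_mul, map_sub, map_add, map_smul, map_zero, map_pow,
        FreeAlgebra.lift_ι_apply] at this
      rw [(cD_of_adj hij ha).1, (cD_of_adj hij ha).2]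
      simpa only [serre, pow_two, mul_assoc, mul_inv, mul_comm qs⁻¹, add_comm qs⁻¹] using this
  case serre_f =>
    intro i j ha
    rcases lt_trichotomy i j with hij | rfl | hij
    · have := genD_rel (.d7a i j hij ha)
      simp only [map_mul, map_sub, map_add, map_smul, map_zero, map_pow,
        FreeAlgebra.lift_ι_apply] at this
      rw [(cD_of_adj hij ha).1, (cD_of_adj hij ha).2,
        ← smul_eq_zero_iff_right (mul_ne_zero hs hr), smul_serre_inv hs hr, ← this,
        mul_comm qs, add_comm qs]
      simp only [pow_two, mul_assoc]
    · exact absurd ha (apaD_self_ne n i)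
    · rw [apaD_comm] at ha
      have := genD_rel (.d7b j i hij ha)
      simp only [map_mul, map_sub, map_add, map_smul, map_zero, map_pow,
        FreeAlgebra.lift_ι_apply] at this
      rw [(cD_of_adj hij ha).1, (cD_of_adj hij ha).2, ← inv_inv qs,
        ← smul_eq_zero_iff_right (mul_ne_zero (inv_ne_zero hr) (inv_ne_zero hs)),
        smul_serre_inv (inv_ne_zero hr) (inv_ne_zero hs), ← this, ← mul_inv]
      simp only [pow_two, mul_assoc]

/-- The comultiplication on generators. -/
def comulGen {n : ℕ} {A : Type*} [Ring A] [Algebra KK A] (φ : Gen (n+2) → A) :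
    Gen (n+2) → A ⊗[KK] A
  | .e i => φ (.e i) ⊗ₜ 1 + φ (.w i) ⊗ₜ φ (.e i)
  | .f i => 1 ⊗ₜ φ (.f i) + φ (.f i) ⊗ₜ φ (.wp i)
  | g => φ g ⊗ₜ φ g

/-- The counit on generators. -/
def counitGen {n : ℕ} : Gen (n+2) → KK
  | .e _ => 0
  | .f _ => 0
  | _ => 1

/-- The antipode on generators, with values in the opposite algebra. -/
def antipodeGen {n : ℕ} {A : Type*} [Ring A] (φ : Gen (n+2) → A) : Gen (n+2) → Aᵐᵒᵖ
  | .e i => .op (-(φ (.winv i) * φ (.e i)))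
  | .f i => .op (-(φ (.f i) * φ (.wpinv i)))
  | .w i => .op (φ (.winv i))
  | .winv i => .op (φ (.w i))
  | .wp i => .op (φ (.wpinv i))
  | .wpinv i => .op (φ (.wp i))

theorem isRep_counitGen (n : ℕ) : IsRep n (counitGen (n := n)) where
  comm _ _ _ _ := mul_comm _ _
  w_mul_winv _ := mul_one _
  wp_mul_wpinv _ := mul_one _
  w_mul_e _ _ := by simp [counitGen]
  w_mul_f _ _ := by simp [counitGen]
  wp_mul_e _ _ := by simp [counitGen]
  wp_mul_f _ _ := by simp [counitGen]
  e_mul_f _ _ := by simp [counitGen]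
  e_mul_e _ _ _ _ := by simp [counitGen]
  f_mul_f _ _ _ _ := by simp [counitGen]
  serre_e _ _ _ := by simp [counitGen, serre]
  serre_f _ _ _ := by simp [counitGen, serre]

namespace IsRep

open Algebra.TensorProduct (tmul_mul_tmul)
open TensorProduct (tmul_smul smul_tmul' tmul_add add_tmul tmul_sub sub_tmul)

variable {n : ℕ} {A : Type*} [Ring A] [Algebra KK A] {φ : Gen (n+2) → A}

theorem w_comm (h : IsRep n φ) (i j : Fin (n+2)) :
    φ (.w i) * φ (.w j) = φ (.w j) * φ (.w i) :=
  h.comm (.w i) (.w j) trivial trivial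

theorem wp_comm (h : IsRep n φ) (i j : Fin (n+2)) :
    φ (.wp i) * φ (.wp j) = φ (.wp j) * φ (.wp i) :=
  h.comm (.wp i) (.wp j) trivial trivial

theorem w_wp_comm (h : IsRep n φ) (i j : Fin (n+2)) :
    φ (.w i) * φ (.wp j) = φ (.wp j) * φ (.w i) :=
  h.comm (.w i) (.wp j) trivial trivial

theorem winv_comm (h : IsRep n φ) (i j : Fin (n+2)) :
    φ (.winv i) * φ (.winv j) = φ (.winv j) * φ (.winv i) :=
  h.comm (.winv i) (.winv j) trivial trivial

theorem wpinv_comm (h : IsRep n φ) (i j : Fin (n+2)) :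
    φ (.wpinv i) * φ (.wpinv j) = φ (.wpinv j) * φ (.wpinv i) :=
  h.comm (.wpinv i) (.wpinv j) trivial trivial

theorem comulGen (h : IsRep n φ) : IsRep n (comulGen φ) where
  comm g g' hg hg' := by
    have := h.comm g g' hg hg'
    cases g <;> first | exact hg.elim | (cases g' <;> first | exact hg'.elim |
      simp only [_root_.comulGen, tmul_mul_tmul, this])
  w_mul_winv i := by
    simp only [_root_.comulGen, tmul_mul_tmul, h.w_mul_winv, Algebra.TensorProduct.one_def]
  wp_mul_wpinv i := by
    simp only [_root_.comulGen, tmul_mul_tmul, h.wp_mul_wpinv, Algebra.TensorProduct.one_def]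
  w_mul_e j i := by
    simp only [_root_.comulGen, mul_add, add_mul, tmul_mul_tmul, h.w_mul_e, h.w_comm j i,
      mul_one, one_mul, tmul_smul, smul_tmul', smul_add]
  w_mul_f j i := by
    simp only [_root_.comulGen, mul_add, add_mul, tmul_mul_tmul, h.w_mul_f, h.w_wp_comm j i,
      mul_one, one_mul, tmul_smul, smul_tmul', smul_add]
  wp_mul_e j i := by
    simp only [_root_.comulGen, mul_add, add_mul, tmul_mul_tmul, h.wp_mul_e, h.w_wp_comm i j,
      mul_one, one_mul, tmul_smul, smul_tmul', smul_add]
  wp_mul_f j i := by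
    simp only [_root_.comulGen, mul_add, add_mul, tmul_mul_tmul, h.wp_mul_f, h.wp_comm j i,
      mul_one, one_mul, tmul_smul, smul_tmul', smul_add]
  e_mul_f i j := by
    have key : _root_.comulGen φ (.e i) * _root_.comulGen φ (.f j) -
        _root_.comulGen φ (.f j) * _root_.comulGen φ (.e i) =
        (φ (.e i) * φ (.f j) - φ (.f j) * φ (.e i)) ⊗ₜ φ (.wp j) +
          φ (.w i) ⊗ₜ (φ (.e i) * φ (.f j) - φ (.f j) * φ (.e i)) := by
      simp only [_root_.comulGen, mul_add, add_mul, tmul_mul_tmul, mul_one, one_mul, h.w_mul_f,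
        h.wp_mul_e, tmul_smul, ← smul_tmul', tmul_sub, sub_tmul]
      abel
    rw [key, h.e_mul_f]
    split_ifs with hij
    · subst hij
      simp only [_root_.comulGen, ← smul_tmul', tmul_smul, ← smul_add, tmul_sub, sub_tmul]
      congr 1
      abel
    · simp
  e_mul_e i j hne ha := by
    have hc := cD_mul_of_orthogonal hne ha
    simp only [_root_.comulGen, mul_add, add_mul, tmul_mul_tmul, mul_one, one_mul, h.w_mul_e j i,
      h.w_mul_e i j, h.e_mul_e i j hne ha, h.w_comm i j, tmul_smul, ← smul_tmul', smul_add,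
      smul_smul, hc, one_smul]
    abel
  f_mul_f i j hne ha := by
    have hc := cD_mul_of_orthogonal hne ha
    simp only [_root_.comulGen, mul_add, add_mul, tmul_mul_tmul, mul_one, one_mul, h.wp_mul_f j i,
      h.wp_mul_f i j, h.f_mul_f i j hne ha, h.wp_comm i j, tmul_smul, ← smul_tmul', smul_add,
      smul_smul, hc, one_smul]
    abel
  serre_e i j ha := by
    have hc := cD_self_of_adj ha
    simp only [_root_.comulGen]
    rw [serre_add (inv_ne_zero (cD_ne_zero n j i)) (cD_ne_zero n i j),
      serre_tmul_left _ _ rfl, serre_tmul_right _ _ (h.w_comm i j), h.serre_e i j ha]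
    · simp
    · simp only [tmul_mul_tmul, h.w_mul_e, hc, mul_one, one_mul, ← smul_tmul']
    · simp only [tmul_mul_tmul, h.w_mul_e, mul_one, one_mul, ← smul_tmul', inv_inv]
    · simp only [tmul_mul_tmul, h.w_mul_e, mul_one, one_mul, ← smul_tmul']
  serre_f i j ha := by
    have hc := cD_self_of_adj ha
    rw [mul_comm] at hc
    simp only [_root_.comulGen]
    rw [serre_add (inv_ne_zero (cD_ne_zero n i j)) (cD_ne_zero n j i),
      serre_tmul_right _ _ rfl, serre_tmul_left _ _ (h.wp_comm i j), h.serre_f i j ha]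
    · simp
    · simp only [tmul_mul_tmul, h.wp_mul_f, hc, mul_one, one_mul, tmul_smul]
    · simp only [tmul_mul_tmul, h.wp_mul_f, mul_one, one_mul, tmul_smul, inv_inv]
    · simp only [tmul_mul_tmul, h.wp_mul_f, mul_one, one_mul, tmul_smul]

theorem antipodeGen (h : IsRep n φ) : IsRep n (antipodeGen φ) where
  comm g g' hg hg' := by
    cases g <;> first | exact hg.elim | (cases g' <;> first | exact hg'.elim |
      exact congrArg MulOpposite.op (h.comm _ _ trivial trivial))
  w_mul_winv i := congrArg MulOpposite.op (h.w_mul_winv i)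
  wp_mul_wpinv i := congrArg MulOpposite.op (h.wp_mul_wpinv i)
  w_mul_e j i := by
    simp only [_root_.antipodeGen, ← MulOpposite.op_mul, ← MulOpposite.op_smul, neg_mul, mul_neg,
      smul_neg]
    rw [mul_assoc, h.e_mul_winv, mul_smul_comm, ← mul_assoc, h.winv_comm i j, mul_assoc]
  w_mul_f j i := by
    simp only [_root_.antipodeGen, ← MulOpposite.op_mul, ← MulOpposite.op_smul, neg_mul, mul_neg,
      smul_neg]
    rw [mul_assoc, ← h.comm (.winv j) (.wpinv i) trivial trivial, ← mul_assoc, h.f_mul_winv,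
      smul_mul_assoc, mul_assoc]
  wp_mul_e j i := by
    simp only [_root_.antipodeGen, ← MulOpposite.op_mul, ← MulOpposite.op_smul, neg_mul, mul_neg,
      smul_neg]
    rw [← mul_assoc, ← h.comm (.winv i) (.wpinv j) trivial trivial, mul_assoc (φ (.winv i)),
      h.e_mul_wpinv, mul_smul_comm, mul_assoc]
  wp_mul_f j i := by
    simp only [_root_.antipodeGen, ← MulOpposite.op_mul, ← MulOpposite.op_smul, neg_mul, mul_neg,
      smul_neg]
    rw [mul_assoc, h.wpinv_comm i j, ← mul_assoc, h.f_mul_wpinv, smul_mul_assoc, mul_assoc]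
  e_mul_f i j := by
    have key : _root_.antipodeGen φ (.e i) * _root_.antipodeGen φ (.f j) -
        _root_.antipodeGen φ (.f j) * _root_.antipodeGen φ (.e i) =
        .op (-(φ (.winv i) * (φ (.e i) * φ (.f j) - φ (.f j) * φ (.e i)) * φ (.wpinv j))) := by
      have h1 : φ (.f j) * φ (.wpinv j) * (φ (.winv i) * φ (.e i)) =
          φ (.winv i) * (φ (.f j) * φ (.e i)) * φ (.wpinv j) := by
        rw [mul_assoc, ← mul_assoc (φ (.wpinv j)), ← h.comm (.winv i) (.wpinv j) trivial trivial,
          mul_assoc (φ (.winv i)), h.wpinv_mul_e, ← mul_assoc, h.f_mul_winv]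
        simp only [smul_mul_assoc, mul_smul_comm, smul_smul, mul_assoc]
        rw [mul_inv_cancel₀ (cD_ne_zero n i j), one_smul]
      simp only [_root_.antipodeGen, ← MulOpposite.op_mul, ← MulOpposite.op_sub, neg_mul, mul_neg,
        neg_neg, h1, mul_sub, sub_mul, neg_sub, mul_assoc]
    rw [key, h.e_mul_f]
    split_ifs with hij
    · subst hij
      simp only [_root_.antipodeGen, ← MulOpposite.op_sub, ← MulOpposite.op_smul]
      rw [mul_smul_comm, smul_mul_assoc, mul_sub, sub_mul, h.winv_mul_w, one_mul, mul_assoc,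
        h.wp_mul_wpinv, mul_one, ← smul_neg, neg_sub]
    · simp
  e_mul_e i j hne ha := by
    simp only [_root_.antipodeGen, ← MulOpposite.op_mul, ← MulOpposite.op_smul, neg_mul, mul_neg,
      neg_neg]
    have h1 (i j : Fin (n+2)) : φ (.winv j) * φ (.e j) * (φ (.winv i) * φ (.e i)) =
        cD n i j • (φ (.winv j) * φ (.winv i) * (φ (.e j) * φ (.e i))) := by
      rw [mul_assoc, ← mul_assoc (φ (.e j)), h.e_mul_winv]
      simp only [smul_mul_assoc, mul_smul_comm, mul_assoc]
    rw [h1, h1, h.e_mul_e i j hne ha, mul_smul_comm, smul_smul (cD n j i), mul_comm (cD n j i),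
      cD_mul_of_orthogonal hne ha, one_smul, h.winv_comm i j]
  f_mul_f i j hne ha := by
    simp only [_root_.antipodeGen, ← MulOpposite.op_mul, ← MulOpposite.op_smul, neg_mul, mul_neg,
      neg_neg]
    have h1 (i j : Fin (n+2)) : φ (.f j) * φ (.wpinv j) * (φ (.f i) * φ (.wpinv i)) =
        (cD n i j)⁻¹ • (φ (.f j) * φ (.f i) * (φ (.wpinv j) * φ (.wpinv i))) := by
      rw [mul_assoc, ← mul_assoc (φ (.wpinv j)), h.wpinv_mul_f]
      simp only [smul_mul_assoc, mul_smul_comm, mul_assoc]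
    rw [h1, h1, h.f_mul_f i j hne ha, smul_mul_assoc, smul_smul (cD n i j)⁻¹,
      inv_mul_cancel₀ (cD_ne_zero n i j), one_smul, h.wpinv_comm i j,
      inv_eq_of_mul_eq_one_left (cD_mul_of_orthogonal hne ha)]
  serre_e i j ha := by
    simp only [_root_.antipodeGen]
    rw [MulOpposite.op_neg, MulOpposite.op_neg, serre_neg,
      serre_op_twist (inv_ne_zero (cD_ne_zero n j i)) (cD_ne_zero n i j) (h.winv_comm j i),
      h.serre_e i j ha]
    · simp
    · rw [h.e_mul_winv, cD_self_of_adj ha]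
    · rw [h.e_mul_winv, inv_inv]
    · rw [h.e_mul_winv]
  serre_f i j ha := by
    simp only [_root_.antipodeGen]
    rw [MulOpposite.op_neg, MulOpposite.op_neg, serre_neg,
      serre_op_twist_right (inv_ne_zero (cD_ne_zero n i j)) (cD_ne_zero n j i)
        (h.wpinv_comm j i), h.serre_f i j ha]
    · simp
    · rw [h.wpinv_mul_f, cD_self_of_adj ha, mul_inv, inv_inv, inv_inv]
    · rw [h.wpinv_mul_f]
    · rw [h.wpinv_mul_f]

/-- The algebra homomorphism from `UD n` determined by a family satisfying the relations. -/
def lift (h : IsRep n φ) : UD n →ₐ[KK] A :=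
  RingQuot.liftAlgHom KK ⟨FreeAlgebra.lift KK φ, fun _ _ hxy => h.lift_rel hxy⟩

theorem lift_genD (h : IsRep n φ) (g : Gen (n+2)) : h.lift (genD n g) = φ g := by
  rw [lift, genD, RingQuot.liftAlgHom_mkAlgHom_apply, FreeAlgebra.lift_ι_apply]

end IsRep

theorem UD.algHom_ext {n : ℕ} {A : Type*} [Semiring A] [Algebra KK A] {f g : UD n →ₐ[KK] A}
    (h : ∀ x, f (genD n x) = g (genD n x)) : f = g :=
  RingQuot.ringQuot_ext' KK f g (FreeAlgebra.hom_ext (funext h))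

theorem UD.induction {n : ℕ} {P : UD n → Prop} (algebraMap : ∀ c : KK, P (algebraMap KK _ c))
    (gen : ∀ g, P (genD n g)) (mul : ∀ x y, P x → P y → P (x * y))
    (add : ∀ x y, P x → P y → P (x + y)) (x : UD n) : P x := by
  obtain ⟨x, rfl⟩ := RingQuot.mkAlgHom_surjective KK (RelD n) x
  induction x using FreeAlgebra.induction with
  | grade0 c => simpa only [AlgHom.commutes] using algebraMap c
  | grade1 g => exact gen g
  | mul x y hx hy => simpa only [map_mul] using mul _ _ hx hy
  | add x y hx hy => simpa only [map_add] using add _ _ hx hy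

section Antipode

theorem add_neg_mul_mul_eq_zero {R : Type*} [Ring R] {u w : R} (x : R) (h : u * w = 1) :
    x + -(x * u) * w = 0 := by
  rw [neg_mul, mul_assoc, h, mul_one, add_neg_cancel]

theorem add_mul_neg_mul_eq_zero {R : Type*} [Ring R] {u w : R} (x : R) (h : w * u = 1) :
    x + w * -(u * x) = 0 := by
  rw [mul_neg, ← mul_assoc, h, one_mul, add_neg_cancel]

variable {K A : Type*} [CommRing K] [Ring A] [Algebra K A] {S : A →ₗ[K] A}

theorem mul'_map_left_mul (hS : ∀ x y, S (x * y) = S y * S x) {t : A ⊗[K] A} {c : K}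
    (ht : LinearMap.mul' K A (TensorProduct.map S LinearMap.id t) = algebraMap K A c)
    (t' : A ⊗[K] A) :
    LinearMap.mul' K A (TensorProduct.map S LinearMap.id (t * t')) =
      c • LinearMap.mul' K A (TensorProduct.map S LinearMap.id t') := by
  induction t' with
  | zero => simp
  | add x y hx hy => rw [mul_add, map_add, map_add, hx, hy, map_add, map_add, smul_add]
  | tmul a b =>
    have h1 : LinearMap.mul' K A (TensorProduct.map S LinearMap.id (t * a ⊗ₜ b)) =
        S a * LinearMap.mul' K A (TensorProduct.map S LinearMap.id t) * b := by
      clear ht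
      induction t with
      | zero => simp
      | add x y hx hy => rw [add_mul, map_add, map_add, hx, hy, map_add, map_add, mul_add, add_mul]
      | tmul x y => simp [hS, mul_assoc]
    rw [h1, ht]
    simp [Algebra.algebraMap_eq_smul_one]

theorem mul'_map_right_mul (hS : ∀ x y, S (x * y) = S y * S x) {t' : A ⊗[K] A} {c : K}
    (ht : LinearMap.mul' K A (TensorProduct.map LinearMap.id S t') = algebraMap K A c)
    (t : A ⊗[K] A) :
    LinearMap.mul' K A (TensorProduct.map LinearMap.id S (t * t')) =
      c • LinearMap.mul' K A (TensorProduct.map LinearMap.id S t) := by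
  induction t with
  | zero => simp
  | add x y hx hy => rw [add_mul, map_add, map_add, hx, hy, map_add, map_add, smul_add]
  | tmul a b =>
    have h1 : LinearMap.mul' K A (TensorProduct.map LinearMap.id S (a ⊗ₜ b * t')) =
        a * LinearMap.mul' K A (TensorProduct.map LinearMap.id S t') * S b := by
      clear ht
      induction t' with
      | zero => simp
      | add x y hx hy => rw [mul_add, map_add, map_add, hx, hy, map_add, map_add, mul_add, add_mul]
      | tmul x y => simp [hS, mul_assoc]
    rw [h1, ht]
    simp [Algebra.algebraMap_eq_smul_one]

end Antipode

theorem stmt2 (n : ℕ) :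
    ∃ (Δ : UD n →ₐ[KK] (UD n ⊗[KK] UD n)) (ε : UD n →ₐ[KK] KK) (S : UD n →ₗ[KK] UD n),
      -- values of Δ on generators
      (∀ i : Fin (n+2),
        Δ (genD n (.w i)) = genD n (.w i) ⊗ₜ[KK] genD n (.w i) ∧
        Δ (genD n (.winv i)) = genD n (.winv i) ⊗ₜ[KK] genD n (.winv i) ∧
        Δ (genD n (.wp i)) = genD n (.wp i) ⊗ₜ[KK] genD n (.wp i) ∧
        Δ (genD n (.wpinv i)) = genD n (.wpinv i) ⊗ₜ[KK] genD n (.wpinv i) ∧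
        Δ (genD n (.e i)) = genD n (.e i) ⊗ₜ[KK] 1 + genD n (.w i) ⊗ₜ[KK] genD n (.e i) ∧
        Δ (genD n (.f i)) = 1 ⊗ₜ[KK] genD n (.f i) + genD n (.f i) ⊗ₜ[KK] genD n (.wp i)) ∧
      -- values of ε on generators
      (∀ i : Fin (n+2),
        ε (genD n (.w i)) = 1 ∧ ε (genD n (.winv i)) = 1 ∧
        ε (genD n (.wp i)) = 1 ∧ ε (genD n (.wpinv i)) = 1 ∧
        ε (genD n (.e i)) = 0 ∧ ε (genD n (.f i)) = 0) ∧
      -- S is an algebra antihomomorphism with the prescribed generator values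
      S 1 = 1 ∧ (∀ x y, S (x * y) = S y * S x) ∧
      (∀ i : Fin (n+2),
        S (genD n (.w i)) = genD n (.winv i) ∧ S (genD n (.winv i)) = genD n (.w i) ∧
        S (genD n (.wp i)) = genD n (.wpinv i) ∧ S (genD n (.wpinv i)) = genD n (.wp i) ∧
        S (genD n (.e i)) = -(genD n (.winv i) * genD n (.e i)) ∧
        S (genD n (.f i)) = -(genD n (.f i) * genD n (.wpinv i))) ∧
      -- coassociativity
      (∀ x, (TensorProduct.assoc KK (UD n) (UD n) (UD n))
          ((TensorProduct.map Δ.toLinearMap LinearMap.id) (Δ x))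
        = (TensorProduct.map LinearMap.id Δ.toLinearMap) (Δ x)) ∧
      -- counit axioms
      (∀ x, (TensorProduct.lid KK (UD n))
          ((TensorProduct.map ε.toLinearMap LinearMap.id) (Δ x)) = x) ∧
      (∀ x, (TensorProduct.rid KK (UD n))
          ((TensorProduct.map LinearMap.id ε.toLinearMap) (Δ x)) = x) ∧
      -- antipode axioms
      (∀ x, (LinearMap.mul' KK (UD n)) ((TensorProduct.map S LinearMap.id) (Δ x))
        = algebraMap KK (UD n) (ε x)) ∧
      (∀ x, (LinearMap.mul' KK (UD n)) ((TensorProduct.map LinearMap.id S) (Δ x))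
        = algebraMap KK (UD n) (ε x)) := by
  have hg := isRep_genD n
  let Δ := hg.comulGen.lift
  let ε := (isRep_counitGen n).lift
  let S' := hg.antipodeGen.lift
  let S : UD n →ₗ[KK] UD n := (MulOpposite.opLinearEquiv KK).symm.toLinearMap ∘ₗ S'.toLinearMap
  have hΔ (g) : Δ (genD n g) = comulGen (genD n) g := hg.comulGen.lift_genD g
  have hε (g) : ε (genD n g) = counitGen g := (isRep_counitGen n).lift_genD g
  have hS (g) : S (genD n g) = (antipodeGen (genD n) g).unop :=
    congrArg MulOpposite.unop (hg.antipodeGen.lift_genD g)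
  have hS_one : S 1 = 1 := congrArg MulOpposite.unop (map_one S')
  have hS_mul (x y) : S (x * y) = S y * S x := congrArg MulOpposite.unop (map_mul S' x y)
  have hS_algebraMap (c : KK) : S (algebraMap KK (UD n) c) = algebraMap KK (UD n) c := by
    rw [Algebra.algebraMap_eq_smul_one, map_smul, hS_one]
  have hwinv := hg.winv_mul_w
  have hwpinv := hg.wpinv_mul_wp
  have hw := hg.w_mul_winv
  have hwp := hg.wp_mul_wpinv
  refine ⟨Δ, ε, S, fun i => ⟨hΔ _, hΔ _, hΔ _, hΔ _, hΔ _, hΔ _⟩,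
    fun i => ⟨hε _, hε _, hε _, hε _, hε _, hε _⟩, hS_one, hS_mul,
    fun i => ⟨hS _, hS _, hS _, hS _, hS _, hS _⟩, fun x => ?_, fun x => ?_, fun x => ?_,
    fun x => ?_, fun x => ?_⟩
  · have key : ((Algebra.TensorProduct.assoc KK KK KK (UD n) (UD n) (UD n)).toAlgHom.comp
        (Algebra.TensorProduct.map Δ (AlgHom.id KK (UD n)))).comp Δ =
        (Algebra.TensorProduct.map (AlgHom.id KK (UD n)) Δ).comp Δ := by
      refine UD.algHom_ext fun g => ?_
      cases g <;> simp [hΔ, comulGen, TensorProduct.add_tmul, TensorProduct.tmul_add,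
        Algebra.TensorProduct.one_def, add_assoc]
    exact DFunLike.congr_fun key x
  · have key : ((Algebra.TensorProduct.lid KK (UD n)).toAlgHom.comp
        (Algebra.TensorProduct.map ε (AlgHom.id KK (UD n)))).comp Δ = AlgHom.id KK (UD n) := by
      refine UD.algHom_ext fun g => ?_
      cases g <;> simp [hΔ, hε, comulGen, counitGen]
    exact DFunLike.congr_fun key x
  · have key : ((Algebra.TensorProduct.rid KK KK (UD n)).toAlgHom.comp
        (Algebra.TensorProduct.map (AlgHom.id KK (UD n)) ε)).comp Δ = AlgHom.id KK (UD n) := by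
      refine UD.algHom_ext fun g => ?_
      cases g <;> simp [hΔ, hε, comulGen, counitGen]
    exact DFunLike.congr_fun key x
  · induction x using UD.induction with
    | algebraMap c => simp [Algebra.TensorProduct.algebraMap_apply, hS_algebraMap]
    | gen g =>
      cases g <;> simp [hΔ, hε, hS, comulGen, counitGen, antipodeGen, hS_one, hwinv,
        hwpinv, hw, hwp]
      exact add_neg_mul_mul_eq_zero _ (hwpinv _)
    | mul x y hx hy =>
      rw [map_mul, mul'_map_left_mul hS_mul hx, hy, map_mul, map_mul, Algebra.smul_def]
    | add x y hx hy => simp only [map_add, hx, hy]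
  · induction x using UD.induction with
    | algebraMap c => simp [Algebra.TensorProduct.algebraMap_apply, hS_one]
    | gen g =>
      cases g <;> simp [hΔ, hε, hS, comulGen, counitGen, antipodeGen, hS_one, hwinv,
        hwpinv, hw, hwp]
      exact add_mul_neg_mul_eq_zero _ (hw _)
    | mul x y hx hy =>
      rw [map_mul, mul'_map_right_mul hS_mul hy, hx, map_mul, map_mul, Algebra.smul_def,
        ← map_mul, mul_comm, map_mul]
    | add x y hx hy => simp only [map_add, hx, hy]

end
end

section
/- Under the stated C_2 Serre hypotheses, the identity T_1(e_2)·T_1'(e_2) = r²·T_1'(e_2)·T_1(e_2) holds in A. -/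
/-!
STATEMENT 16. Let K = ℚ(r,s) (realized as the fraction field of ℚ[r,s]).
Let A be an associative unital K-algebra containing elements e₁, e₂ satisfying the
type C₂ (r,s)-Serre relations.  Set e₁^{(2)} = e₁²/⟨2⟩₁ with ⟨2⟩₁ = r⁻¹ + s⁻¹, and
  T₁(e₂) = e₂e₁^{(2)} − s⁻¹e₁e₂e₁ + r⁻¹s⁻³e₁^{(2)}e₂,
  T₁'(e₂) = e₁e₂ − s²e₂e₁.
Then T₁(e₂)·T₁'(e₂) = r²·T₁'(e₂)·T₁(e₂).
-/

noncomputable section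

/-- The `(r,s)`-commutation of the two root vectors over an arbitrary field: the difference of the
two sides lies in the ideal generated by the Serre relations. -/
theorem rootVectors_rsCommute {F A : Type*} [Field F] [Ring A] [Algebra F A] {r s : F}
    (hr : r ≠ 0) (hs : s ≠ 0) (hrs : r + s ≠ 0) (e₁ e₂ : A)
    (serre1 : e₁^3 * e₂ - (r^2 + r*s + s^2) • (e₁^2 * e₂ * e₁)
      + (r*s*(r^2 + r*s + s^2)) • (e₁ * e₂ * e₁^2) - ((r*s)^3) • (e₂ * e₁^3) = 0)
    (serre2 : e₂^2 * e₁ - (r^(-2:ℤ) + s^(-2:ℤ)) • (e₂ * e₁ * e₂)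
      + ((r*s)^(-2:ℤ)) • (e₁ * e₂^2) = 0) :
    (e₂ * ((r⁻¹ + s⁻¹)⁻¹ • e₁^2) - s⁻¹ • (e₁ * e₂ * e₁)
        + (r⁻¹ * s^(-3:ℤ)) • (((r⁻¹ + s⁻¹)⁻¹ • e₁^2) * e₂))
      * (e₁ * e₂ - s^2 • (e₂ * e₁))
    = r^2 • ((e₁ * e₂ - s^2 • (e₂ * e₁)) *
        (e₂ * ((r⁻¹ + s⁻¹)⁻¹ • e₁^2) - s⁻¹ • (e₁ * e₂ * e₁)
          + (r⁻¹ * s^(-3:ℤ)) • (((r⁻¹ + s⁻¹)⁻¹ • e₁^2) * e₂))) := by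
  have hk : (r⁻¹ + s⁻¹)⁻¹ = r * s / (r + s) := by
    rw [inv_add_inv hr hs, inv_div]
  have h₁ := congrArg (fun x => (-1 / (r * s^3 * (r + s))) • (x * e₂)
    + (r * s / (r + s)) • (e₂ * x)) serre1
  have h₂ := congrArg (fun x => ((r * s)^4 / (r + s)) • (x * e₁^2)
    - (r^2 * s) • (e₁ * x * e₁) + (r / (s * (r + s))) • (e₁^2 * x)) serre2
  simp only [mul_zero, zero_mul, smul_zero, add_zero, sub_zero] at h₁ h₂
  rw [← sub_eq_zero, ← add_zero (0 : A)]
  nth_rw 1 [← h₁]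
  rw [← h₂, hk]
  simp only [pow_succ, pow_zero, one_mul, mul_add, add_mul, mul_sub, sub_mul, smul_mul_assoc,
    mul_smul_comm, smul_smul, smul_add, smul_sub, mul_assoc, zpow_neg]
  match_scalars <;> field_simp <;> ring

theorem stmt16 (A : Type*) [Ring A] [Algebra KK A] (e₁ e₂ : A)
    (serre1 : e₁^3 * e₂ - (qr^2 + qr*qs + qs^2) • (e₁^2 * e₂ * e₁)
      + (qr*qs*(qr^2 + qr*qs + qs^2)) • (e₁ * e₂ * e₁^2) - ((qr*qs)^3) • (e₂ * e₁^3) = 0)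
    (serre2 : e₂^2 * e₁ - (qr^(-2:ℤ) + qs^(-2:ℤ)) • (e₂ * e₁ * e₂)
      + ((qr*qs)^(-2:ℤ)) • (e₁ * e₂^2) = 0) :
    (e₂ * ((qr⁻¹ + qs⁻¹)⁻¹ • e₁^2) - qs⁻¹ • (e₁ * e₂ * e₁)
        + (qr⁻¹ * qs^(-3:ℤ)) • (((qr⁻¹ + qs⁻¹)⁻¹ • e₁^2) * e₂))
      * (e₁ * e₂ - qs^2 • (e₂ * e₁))
    = qr^2 • ((e₁ * e₂ - qs^2 • (e₂ * e₁)) *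
        (e₂ * ((qr⁻¹ + qs⁻¹)⁻¹ • e₁^2) - qs⁻¹ • (e₁ * e₂ * e₁)
          + (qr⁻¹ * qs^(-3:ℤ)) • (((qr⁻¹ + qs⁻¹)⁻¹ • e₁^2) * e₂))) := by
  have hX (i : Fin 2) : algebraMap (MvPolynomial (Fin 2) ℚ) KK (MvPolynomial.X i) ≠ 0 := by
    simp
  have hsum : qr + qs ≠ 0 := by
    rw [qr, qs, ← map_add, Ne, FaithfulSMul.algebraMap_eq_zero_iff]
    intro h
    simpa using congrArg (MvPolynomial.eval ![1, 0]) h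
  exact rootVectors_rsCommute (hX 0) (hX 1) hsum e₁ e₂ serre1 serre2

end
end
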